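/- Finite frame property of NRA_{m,n}: for any formula ψ, the following are equivalent: (1) NRA_{m,n} ⊢ ψ; (2) ψ is valid on every (m,n)-accessible N-frame; (3) ψ is valid on every finite (m,n)-accessible N-frame; (4) ψ is valid on every finite Sub(ψ)-(m,n)-accessible N-frame. -/

import Mathlib

inductive Formula : Type
  | bot : Formula
  | var : ℕ → Formula
  | neg : Formula → Formula
  | or : Formula → Formula → Formula
  | box : Formula → Formula
  deriving DecidableEq

namespace Formula

def imp (φ ψ : Formula) : Formula := .or (.neg φ) ψ

def and (φ ψ : Formula) : Formula := .neg (.or (.neg φ) (.neg ψ))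

/-- □^n φ -/
def boxn : ℕ → Formula → Formula
  | 0, φ => φ
  | k+1, φ => .box (boxn k φ)

/-- the set of subformulas -/
def sub : Formula → Finset Formula
  | .bot => {.bot}
  | .var p => {.var p}
  | .neg φ => insert (.neg φ) φ.sub
  | .or φ ψ => insert (.or φ ψ) (φ.sub ∪ ψ.sub)
  | .box φ => insert (.box φ) φ.sub

/-- ∼ρ -/
def negg : Formula → Formula
  | .neg φ => φ
  | φ => .neg φ

end Formula

def NSub (ψ : Formula) : Finset Formula := ψ.sub ∪ ψ.sub.image Formula.negg

/-- boolean evaluation treating boxed formulas and variables as atoms -/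
def evalP (v : Formula → Bool) : Formula → Bool
  | .bot => false
  | .var p => v (.var p)
  | .neg φ => !(evalP v φ)
  | .or φ ψ => evalP v φ || evalP v ψ
  | .box φ => v (.box φ)

/-- propositional tautologies in the modal language -/
def Tautology (φ : Formula) : Prop := ∀ v, evalP v φ = true

/-- Provability in NA_{m,n} (ros = false) and NRA_{m,n} (ros = true):
    propositional tautologies, the scheme □^n φ → □^m φ, modus ponens,
    necessitation, and (if ros) the rule Ros^□ : ¬□φ / ¬□□φ. -/
inductive Prov (m n : ℕ) (ros : Bool) : Formula → Prop
  | taut {φ} : Tautology φ → Prov m n ros φ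
  | axA (φ) : Prov m n ros ((Formula.boxn n φ).imp (Formula.boxn m φ))
  | mp {φ ψ} : Prov m n ros (φ.imp ψ) → Prov m n ros φ → Prov m n ros ψ
  | nec {φ} : Prov m n ros φ → Prov m n ros (.box φ)
  | ros {φ} : ros = true → Prov m n ros (.neg (.box φ)) →
      Prov m n ros (.neg (.box (.box φ)))

/-- An N-frame on world set W: a binary relation R_φ for each formula φ. -/
abbrev NFrame (W : Type) := Formula → W → W → Prop

structure NModel (W : Type) where
  Rel : NFrame W
  V : W → ℕ → Prop

/-- satisfaction in an N-model -/
def Sat {W : Type} (M : NModel W) : W → Formula → Prop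
  | _, .bot => False
  | w, .var p => M.V w p
  | w, .neg φ => ¬ Sat M w φ
  | w, .or φ ψ => Sat M w φ ∨ Sat M w ψ
  | w, .box φ => ∀ w', M.Rel φ w w' → Sat M w' φ

/-- x R_φ^k y : there is a φ-path of length k from x to y -/
def FPath {W : Type} (R : NFrame W) (φ : Formula) : ℕ → W → W → Prop
  | 0, x, y => x = y
  | k+1, x, y => ∃ w, R (Formula.boxn k φ) x w ∧ FPath R φ k w y

/-- (m,n)-accessibility for φ -/
def AccFor {W : Type} (R : NFrame W) (m n : ℕ) (φ : Formula) : Prop :=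
  ∀ x y, FPath R φ m x y → FPath R φ n x y

/-- Γ-(m,n)-accessibility -/
def SubAcc {W : Type} (R : NFrame W) (m n : ℕ) (Γ : Finset Formula) : Prop :=
  ∀ φ, Formula.boxn m φ ∈ Γ → AccFor R m n φ

/-- (m,n)-accessibility -/
def Accessible {W : Type} (R : NFrame W) (m n : ℕ) : Prop :=
  ∀ φ, AccFor R m n φ

def ValidM {W : Type} (M : NModel W) (ψ : Formula) : Prop := ∀ w, Sat M w ψ

def ValidF {W : Type} (R : NFrame W) (ψ : Formula) : Prop :=
  ∀ V : W → ℕ → Prop, ValidM ⟨R, V⟩ ψ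



namespace Formula

lemma self_mem_sub (φ : Formula) : φ ∈ φ.sub := by
  cases φ <;> simp [sub]

lemma sub_trans {α φ ψ : Formula} (h : α ∈ φ.sub) (h' : φ ∈ ψ.sub) : α ∈ ψ.sub := by
  induction ψ with
  | bot => simp only [sub, Finset.mem_singleton] at h'; subst h'; exact h
  | var p => simp only [sub, Finset.mem_singleton] at h'; subst h'; exact h
  | neg χ ih =>
    rcases Finset.mem_insert.1 h' with rfl | h'
    · exact h
    · exact Finset.mem_insert_of_mem (ih h')
  | or χ ξ ih₁ ih₂ =>
    rcases Finset.mem_insert.1 h' with rfl | h'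
    · exact h
    · rcases Finset.mem_union.1 h' with h' | h'
      · exact Finset.mem_insert_of_mem (Finset.mem_union_left _ (ih₁ h'))
      · exact Finset.mem_insert_of_mem (Finset.mem_union_right _ (ih₂ h'))
  | box χ ih =>
    rcases Finset.mem_insert.1 h' with rfl | h'
    · exact h
    · exact Finset.mem_insert_of_mem (ih h')

lemma mem_sub_of_box {φ ψ : Formula} (h : box φ ∈ ψ.sub) : φ ∈ ψ.sub :=
  sub_trans (Finset.mem_insert_of_mem (self_mem_sub φ)) h

lemma mem_sub_of_boxn {φ ψ : Formula} (k : ℕ) (h : boxn k φ ∈ ψ.sub) : φ ∈ ψ.sub := by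
  induction k with
  | zero => exact h
  | succ k ih => exact ih (mem_sub_of_box h)

lemma boxn_add (a b : ℕ) (φ : Formula) : boxn (a + b) φ = boxn a (boxn b φ) := by
  induction a with
  | zero => simp [boxn]
  | succ a ih => rw [Nat.succ_add]; simp [boxn, ih]

lemma boxn_box (k : ℕ) (φ : Formula) : boxn k (box φ) = box (boxn k φ) :=
  (boxn_add k 1 φ).symm

lemma mem_sub_boxn_of_le {φ ψ : Formula} {k l : ℕ} (hkl : k ≤ l) (h : boxn l φ ∈ ψ.sub) :
    boxn k φ ∈ ψ.sub := by
  obtain ⟨d, rfl⟩ := Nat.exists_eq_add_of_le' hkl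
  rw [boxn_add] at h
  exact mem_sub_of_boxn d h

lemma sizeOf_le_of_mem_sub {φ ψ : Formula} (h : φ ∈ ψ.sub) : sizeOf φ ≤ sizeOf ψ := by
  induction ψ with
  | bot => simp only [sub, Finset.mem_singleton] at h; rw [h]
  | var p => simp only [sub, Finset.mem_singleton] at h; rw [h]
  | neg χ ih =>
    rcases Finset.mem_insert.1 h with rfl | h
    · exact le_rfl
    · have := ih h; simp only [neg.sizeOf_spec]; omega
  | or χ ξ ih₁ ih₂ =>
    rcases Finset.mem_insert.1 h with rfl | h
    · exact le_rfl
    · simp only [or.sizeOf_spec]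
      rcases Finset.mem_union.1 h with h | h
      · have := ih₁ h; omega
      · have := ih₂ h; omega
  | box χ ih =>
    rcases Finset.mem_insert.1 h with rfl | h
    · exact le_rfl
    · have := ih h; simp only [box.sizeOf_spec]; omega

lemma sizeOf_boxn (k : ℕ) (φ : Formula) : sizeOf (boxn k φ) = k + sizeOf φ := by
  induction k with
  | zero => simp [boxn]
  | succ k ih => simp only [boxn, box.sizeOf_spec, ih]; omega

/-- the formula obtained by stripping all leading boxes -/
def core : Formula → Formula
  | .box φ => φ.core
  | φ => φ

/-- the number of leading boxes -/
def depth : Formula → ℕ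
  | .box φ => φ.depth + 1
  | _ => 0

lemma boxn_depth_core (φ : Formula) : boxn φ.depth φ.core = φ := by
  induction φ with
  | box φ ih => simp [boxn, core, depth, ih]
  | _ => rfl

lemma core_boxn (k : ℕ) (φ : Formula) : (boxn k φ).core = φ.core := by
  induction k with
  | zero => rfl
  | succ k ih => simpa [boxn, core] using ih

lemma depth_boxn (k : ℕ) (φ : Formula) : (boxn k φ).depth = k + φ.depth := by
  induction k with
  | zero => simp [boxn]
  | succ k ih => simp only [boxn, depth, ih]; omega

lemma depth_core (φ : Formula) : φ.core.depth = 0 := by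
  induction φ with
  | box φ ih => exact ih
  | _ => rfl

lemma core_of_depth {φ : Formula} (h : φ.depth = 0) : φ.core = φ := by
  have := boxn_depth_core φ
  rwa [h] at this

lemma eq_boxn_of_boxn_eq {a b : ℕ} {ρ χ : Formula} (hχ : χ.depth = 0)
    (h : boxn a ρ = boxn b χ) : b = a + ρ.depth ∧ ρ = boxn ρ.depth χ := by
  have h₁ := congrArg depth h
  have h₂ := congrArg core h
  rw [depth_boxn, depth_boxn, hχ] at h₁
  rw [core_boxn, core_boxn, core_of_depth hχ] at h₂
  refine ⟨by omega, ?_⟩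
  rw [← h₂, boxn_depth_core]

/-- the formula obtained by stripping as many blocks of `m` boxes as possible -/
def root (m : ℕ) (φ : Formula) : Formula := boxn (φ.depth % m) φ.core

lemma root_boxn (m : ℕ) (φ : Formula) : (boxn m φ).root m = φ.root m := by
  simp [root, core_boxn, depth_boxn]

lemma boxn_root (m : ℕ) (φ : Formula) : boxn (m * (φ.depth / m)) (φ.root m) = φ := by
  rw [root, ← boxn_add, Nat.div_add_mod, boxn_depth_core]

end Formula

open Formula

section Semantics

variable {W : Type}

lemma sat_boxn_iff (M : NModel W) (φ : Formula) (k : ℕ) (w : W) :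
    Sat M w (boxn k φ) ↔ ∀ y, FPath M.Rel φ k w y → Sat M y φ := by
  induction k generalizing w with
  | zero => simp [boxn, FPath]
  | succ k ih =>
    simp only [boxn, Sat, FPath, ih]
    exact ⟨fun h y ⟨u, hu, hy⟩ => h u hu y hy, fun h u hu y hy => h y ⟨u, hu, hy⟩⟩

open Classical in
lemma evalP_sat_iff (M : NModel W) (w : W) (φ : Formula) :
    evalP (fun α => decide (Sat M w α)) φ = true ↔ Sat M w φ := by
  induction φ with
  | neg φ ih => simp only [evalP, Sat, ← ih, Bool.not_eq_true', Bool.not_eq_true]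
  | or φ ψ ih₁ ih₂ => simp only [evalP, Sat, ← ih₁, ← ih₂, Bool.or_eq_true]
  | bot => simp [evalP, Sat]
  | _ => exact decide_eq_true_iff

lemma sat_imp (M : NModel W) (w : W) (φ ψ : Formula) :
    Sat M w (φ.imp ψ) ↔ (Sat M w φ → Sat M w ψ) := by
  simp only [imp, Sat]; tauto

lemma validF_boxn_imp {m n : ℕ} {R : NFrame W} {φ : Formula} (h : AccFor R m n φ) :
    ValidF R ((boxn n φ).imp (boxn m φ)) := by
  intro V w
  rw [sat_imp, sat_boxn_iff, sat_boxn_iff]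
  exact fun hn y hy => hn y (h w y hy)

end Semantics

lemma accessible_empty {m n : ℕ} (h : m = 0 → n = 0) :
    Accessible (fun _ _ _ => False : NFrame Unit) m n := by
  intro φ x y hxy
  cases m with
  | zero => rw [h rfl]; exact hxy
  | succ m => obtain ⟨_, hf, _⟩ := hxy; exact hf.elim

/-- two worlds, all relations total except that the world `false` has no `φ`-successor -/
def blockedFrame (φ : Formula) : NFrame Bool := fun ρ x _ => ρ = φ → x = true

lemma fpath_blockedFrame (φ θ : Formula) (k : ℕ) (y : Bool) :
    FPath (blockedFrame φ) θ (k + 1) true y := by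
  induction k with
  | zero => exact ⟨y, fun _ => rfl, rfl⟩
  | succ k ih => exact ⟨true, fun _ => rfl, ih⟩

lemma accessible_blockedFrame {φ : Formula} {k : ℕ} (h : ¬ ∃ χ, φ = boxn k χ) :
    Accessible (blockedFrame φ) 0 (k + 1) := by
  intro θ x y hxy
  obtain rfl : x = y := hxy
  cases k with
  | zero => exact absurd ⟨φ, rfl⟩ h
  | succ k => exact ⟨true, fun e => absurd ⟨θ, e.symm⟩ h, fpath_blockedFrame φ θ k x⟩

theorem validF_of_prov {m n : ℕ} {ψ : Formula} (h : Prov m n true ψ) :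
    ∀ (W : Type) [Nonempty W] (R : NFrame W), Accessible R m n → ValidF R ψ := by
  classical
  induction h with
  | taut h =>
    intro W _ R _ V w
    exact (evalP_sat_iff ⟨R, V⟩ w _).1 (h _)
  | axA φ => exact fun W _ R hR => validF_boxn_imp (hR φ)
  | mp _ _ ih₁ ih₂ =>
    intro W _ R hR V w
    exact (sat_imp _ _ _ _).1 (ih₁ W R hR V w) (ih₂ W R hR V w)
  | nec _ ih => exact fun W _ R hR V w w' _ => ih W R hR V w'
  | @ros φ _ _ ih =>
    by_cases hmn : m = 0 → n = 0
    · exact absurd (fun _ hf => hf.elim)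
        (ih Unit _ (accessible_empty hmn) (fun _ _ => True) ())
    · push Not at hmn
      obtain ⟨rfl, hn⟩ := hmn
      obtain ⟨k, rfl⟩ := Nat.exists_eq_succ_of_ne_zero hn
      by_cases hφ : ∃ χ, φ = boxn k χ
      · obtain ⟨χ, rfl⟩ := hφ
        intro W _ R hR V w hw
        obtain ⟨u, hu, -⟩ := hR (box χ) w w rfl
        rw [boxn_box] at hu
        exact ih W R hR V u (hw u hu)
      · exact absurd (fun _ hf => absurd (hf rfl) (by simp))
          (ih Bool _ (accessible_blockedFrame hφ) (fun _ _ => True) false)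

section Extension

variable {W : Type}

/-- keep `R` on the formulas boxed in `Γ`; elsewhere use the full relation or the empty one,
according to whether `m ≤ n` -/
def trimFrame (R : NFrame W) (m n : ℕ) (Γ : Finset Formula) : NFrame W :=
  fun ρ x y => if box ρ ∈ Γ then R ρ x y else m ≤ n

lemma fpath_trimFrame_iff (R : NFrame W) (m n : ℕ) {ψ φ : Formula} {k : ℕ}
    (h : boxn k φ ∈ ψ.sub) (x y : W) :
    FPath (trimFrame R m n ψ.sub) φ k x y ↔ FPath R φ k x y := by
  induction k generalizing x with
  | zero => rfl
  | succ k ih =>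
    have h' : box (boxn k φ) ∈ ψ.sub := h
    simp only [FPath, ih (mem_sub_of_box h'), trimFrame, h', if_true]

lemma fpath_trimFrame_of_le {R : NFrame W} {m n : ℕ} (hmn : m ≤ n) {Γ : Finset Formula}
    {φ : Formula} {k : ℕ} {x y : W} (h : FPath R φ k x y) :
    FPath (trimFrame R m n Γ) φ k x y := by
  induction k generalizing x with
  | zero => exact h
  | succ k ih =>
    obtain ⟨u, hu, hy⟩ := h
    refine ⟨u, ?_, ih hy⟩
    unfold trimFrame
    split_ifs
    exacts [hu, hmn]

lemma accessible_trimFrame {R : NFrame W} {m n : ℕ} {ψ : Formula} (hR : SubAcc R m n ψ.sub) :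
    Accessible (trimFrame R m n ψ.sub) m n := by
  intro φ x y hxy
  by_cases hφ : boxn m φ ∈ ψ.sub
  · have h := hR φ hφ x y ((fpath_trimFrame_iff R m n hφ x y).1 hxy)
    rcases le_total m n with hmn | hmn
    · exact fpath_trimFrame_of_le hmn h
    · exact (fpath_trimFrame_iff R m n (mem_sub_boxn_of_le hmn hφ) x y).2 h
  · by_cases hmn : m ≤ n
    · obtain ⟨d, rfl⟩ := Nat.exists_eq_add_of_le hmn
      suffices ∀ d', FPath (trimFrame R m (m + d) ψ.sub) φ (m + d') x y from this d
      intro d'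
      induction d' with
      | zero => exact hxy
      | succ d' ih =>
        refine ⟨x, ?_, ih⟩
        have : box (boxn (m + d') φ) ∉ ψ.sub := fun h =>
          hφ (mem_sub_boxn_of_le (Nat.le_add_right m d') (mem_sub_of_box h))
        simp [trimFrame, this]
    · obtain ⟨k, rfl⟩ : ∃ k, m = k + 1 := Nat.exists_eq_succ_of_ne_zero (by omega)
      obtain ⟨u, hu, -⟩ := hxy
      have : box (boxn k φ) ∉ ψ.sub := hφ
      simp only [trimFrame, this, if_false] at hu
      exact absurd hu hmn

lemma sat_trimFrame_iff (R : NFrame W) (m n : ℕ) (ψ : Formula) (V : W → ℕ → Prop)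
    {φ : Formula} (h : φ ∈ ψ.sub) (w : W) :
    Sat ⟨trimFrame R m n ψ.sub, V⟩ w φ ↔ Sat ⟨R, V⟩ w φ := by
  induction φ generalizing w with
  | bot => rfl
  | var p => rfl
  | neg φ ih =>
    exact not_congr (ih (sub_trans (Finset.mem_insert_of_mem (self_mem_sub φ)) h) w)
  | or φ χ ih₁ ih₂ =>
    exact or_congr
      (ih₁ (sub_trans (Finset.mem_insert_of_mem (Finset.mem_union_left _ (self_mem_sub φ))) h) w)
      (ih₂ (sub_trans (Finset.mem_insert_of_mem (Finset.mem_union_right _ (self_mem_sub χ))) h) w)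
  | box φ ih => simp only [Sat, ih (mem_sub_of_box h), trimFrame, h, if_true]

end Extension

section Valuations

variable {m n : ℕ}

lemma evalP_imp (v : Formula → Bool) (φ ψ : Formula) :
    evalP v (φ.imp ψ) = true ↔ (evalP v φ = true → evalP v ψ = true) := by
  simp only [imp, evalP]
  cases evalP v φ <;> simp

lemma evalP_congr {v v' : Formula → Bool} {φ : Formula} (h : ∀ α ∈ φ.sub, v α = v' α) :
    evalP v φ = evalP v' φ := by
  induction φ with
  | bot => rfl
  | var p => exact h _ (self_mem_sub _)
  | neg φ ih => simp only [evalP, ih fun α hα => h α (Finset.mem_insert_of_mem hα)]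
  | or φ ψ ih₁ ih₂ =>
    simp only [evalP,
      ih₁ fun α hα => h α (Finset.mem_insert_of_mem (Finset.mem_union_left _ hα)),
      ih₂ fun α hα => h α (Finset.mem_insert_of_mem (Finset.mem_union_right _ hα))]
  | box φ _ => exact h _ (self_mem_sub _)

lemma continuous_evalP (φ : Formula) : Continuous fun v : Formula → Bool => evalP v φ := by
  induction φ with
  | bot => exact continuous_const
  | var p => exact continuous_apply _
  | neg φ ih => exact (continuous_of_discreteTopology (f := not)).comp ih
  | or φ ψ ih₁ ih₂ =>
    exact (continuous_of_discreteTopology (f := fun p : Bool × Bool => p.1 || p.2)).comp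
      (ih₁.prodMk ih₂)
  | box φ _ => exact continuous_apply _

/-- a valuation of the atoms under which every theorem is true -/
def Coherent (m n : ℕ) (v : Formula → Bool) : Prop :=
  ∀ φ, Prov m n true φ → evalP v φ = true

lemma prov_of_finset_entails (u : Finset {θ // Prov m n true θ}) {φ : Formula}
    (h : ∀ v, (∀ θ ∈ u, evalP v θ = true) → evalP v φ = true) : Prov m n true φ := by
  classical
  induction u using Finset.induction_on generalizing φ with
  | empty => exact .taut fun v => h v (by simp)
  | insert θ u _ ih =>
    refine .mp (ih (φ := θ.1.imp φ) fun v hv => ?_) θ.2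
    rw [evalP_imp]
    exact fun hθ => h v ((Finset.forall_mem_insert _ _ _).2 ⟨hθ, hv⟩)

lemma exists_coherent {φ : Formula} (h : ¬ Prov m n true φ) :
    ∃ v, Coherent m n v ∧ evalP v φ = false := by
  by_contra hc
  have hK : IsCompact {v : Formula → Bool | evalP v φ = false} :=
    (isClosed_eq (continuous_evalP φ) continuous_const).isCompact
  obtain ⟨u, hu⟩ := hK.elim_finite_subfamily_closed
    (fun θ : {θ // Prov m n true θ} => {v | evalP v θ.1 = true})
    (fun θ => isClosed_eq (continuous_evalP θ.1) continuous_const) (by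
      ext v
      simp only [Set.mem_inter_iff, Set.mem_ofPred_eq, Set.mem_iInter, Set.mem_empty_iff_false,
        iff_false]
      exact fun hv => hc ⟨v, fun θ hθ => hv.2 ⟨θ, hθ⟩, hv.1⟩)
  refine h (prov_of_finset_entails u fun v hv => ?_)
  by_contra hφ
  have : v ∈ (∅ : Set (Formula → Bool)) := by
    rw [← hu]
    exact ⟨by simpa using hφ, by simpa using fun θ hθ => hv ⟨θ, hθ⟩⟩
  exact this

lemma coherent_of {v : Formula → Bool}
    (hnec : ∀ φ, Prov m n true φ → v (box φ) = true)
    (hax : ∀ φ, evalP v (boxn n φ) = true → evalP v (boxn m φ) = true)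
    (hros : ∀ φ, Prov m n true (neg (box φ)) → v (box (box φ)) = false) :
    Coherent m n v := by
  intro φ h
  induction h with
  | taut h => exact h v
  | axA φ => exact (evalP_imp _ _ _).2 (hax φ)
  | mp _ _ ih₁ ih₂ => exact (evalP_imp _ _ _).1 ih₁ ih₂
  | nec h _ => exact hnec _ h
  | ros _ h _ => simp [evalP, hros _ h]

lemma Coherent.boxn_imp {v : Formula → Bool} (hv : Coherent m n v) {φ : Formula}
    (h : evalP v (boxn n φ) = true) : evalP v (boxn m φ) = true :=
  (evalP_imp _ _ _).1 (hv _ (.axA φ)) h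

lemma prov_boxn {φ : Formula} (k : ℕ) (h : Prov m n true φ) : Prov m n true (boxn k φ) := by
  induction k with
  | zero => exact h
  | succ k ih => exact .nec ih

lemma prov_boxn_of_le {φ : Formula} {k l : ℕ} (hkl : k ≤ l) (h : Prov m n true (boxn k φ)) :
    Prov m n true (boxn l φ) := by
  obtain ⟨d, rfl⟩ := Nat.exists_eq_add_of_le' hkl
  rw [boxn_add]
  exact prov_boxn d h

lemma prov_neg_boxn_of_le {φ : Formula} {k l : ℕ} (hkl : k ≤ l)
    (h : Prov m n true (neg (boxn (k + 1) φ))) : Prov m n true (neg (boxn (l + 1) φ)) := by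
  induction l, hkl using Nat.le_induction with
  | base => exact h
  | succ l _ ih => exact .ros rfl ih

variable (m n) in
/-- finitely many coherent valuations representing all coherent ones on a finite set -/
lemma exists_finite_representatives (Γ : Finset Formula) :
    ∃ (W : Type) (_ : Fintype W) (val : W → Formula → Bool), (∀ w, Coherent m n (val w)) ∧
      ∀ v, Coherent m n v → ∃ w, ∀ ρ ∈ Γ, evalP (val w) ρ = evalP v ρ := by
  classical
  let f : {v // Coherent m n v} → (Γ → Bool) := fun v ρ => evalP v.1 ρ
  refine ⟨Set.range f, Fintype.ofFinite _, fun w => (Classical.choose w.2).1,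
    fun w => (Classical.choose w.2).2, fun v hv => ⟨⟨f ⟨v, hv⟩, Set.mem_range_self _⟩,
      fun ρ hρ => ?_⟩⟩
  exact congrFun (Classical.choose_spec (Set.mem_range_self (f := f) ⟨v, hv⟩)) ⟨ρ, hρ⟩

lemma sat_iff_evalP {W : Type} {R : NFrame W} {val : W → Formula → Bool} {ψ : Formula}
    (h : ∀ ρ w, box ρ ∈ ψ.sub →
      (val w (box ρ) = true ↔ ∀ w', R ρ w w' → evalP (val w') ρ = true))
    {φ : Formula} (hφ : φ ∈ ψ.sub) (w : W) :
    Sat ⟨R, fun w p => val w (var p) = true⟩ w φ ↔ evalP (val w) φ = true := by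
  induction φ generalizing w with
  | bot => simp [Sat, evalP]
  | var p => rfl
  | neg φ ih =>
    simp [Sat, evalP, ih (sub_trans (Finset.mem_insert_of_mem (self_mem_sub φ)) hφ)]
  | or φ χ ih₁ ih₂ =>
    simp [Sat, evalP,
      ih₁ (sub_trans (Finset.mem_insert_of_mem (Finset.mem_union_left _ (self_mem_sub φ))) hφ),
      ih₂ (sub_trans (Finset.mem_insert_of_mem (Finset.mem_union_right _ (self_mem_sub χ))) hφ)]
  | box φ ih =>
    simp only [Sat, ih (mem_sub_of_box hφ)]
    exact (h φ w hφ).symm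

end Valuations

/-- `ψ` fails on some finite frame that is accessible for its subformulas -/
def HasFiniteCountermodel (m n : ℕ) (ψ : Formula) : Prop :=
  ∃ (W : Type) (_ : Fintype W) (_ : Nonempty W) (R : NFrame W),
    SubAcc R m n ψ.sub ∧ ¬ ValidF R ψ

lemma hasFiniteCountermodel_of_truth {m n : ℕ} {ψ : Formula} {W : Type} [Fintype W]
    {R : NFrame W} {val : W → Formula → Bool} (hR : SubAcc R m n ψ.sub)
    (h : ∀ ρ w, box ρ ∈ ψ.sub →
      (val w (box ρ) = true ↔ ∀ w', R ρ w w' → evalP (val w') ρ = true))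
    {w₀ : W} (hw₀ : evalP (val w₀) ψ = false) : HasFiniteCountermodel m n ψ := by
  refine ⟨W, inferInstance, ⟨w₀⟩, R, hR, fun hv => ?_⟩
  have := (sat_iff_evalP h (self_mem_sub ψ) w₀).1 (hv _ w₀)
  simp [hw₀] at this

section CanonicalModels

variable {m n : ℕ} {W : Type} {val : W → Formula → Bool} {ψ : Formula}

/-- the largest relations making the truth lemma hold on the subformulas of `ψ` -/
def maxFrame (val : W → Formula → Bool) (ψ : Formula) : NFrame W := fun ρ x y =>
  box ρ ∈ ψ.sub → val x (box ρ) = true → evalP (val y) ρ = true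

/-- on the subformulas of `ψ`, the smallest natural relations making the truth lemma hold -/
def minFrame (val : W → Formula → Bool) (ψ : Formula) : NFrame W := fun ρ x y =>
  box ρ ∈ ψ.sub → val x (box ρ) = false ∧ evalP (val y) ρ = false

lemma fpath_minFrame (hrep : ∀ ρ, ¬ Prov m n true ρ → ∃ w, ρ ∈ ψ.sub → evalP (val w) ρ = false)
    {φ : Formula} {k : ℕ} (hφ : ¬ Prov m n true (boxn (k + 1) φ)) {x y : W}
    (hx : boxn (k + 1) φ ∈ ψ.sub → val x (boxn (k + 1) φ) = false)
    (hy : evalP (val y) φ = false) : FPath (minFrame val ψ) φ (k + 1) x y := by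
  induction k generalizing x with
  | zero => exact ⟨y, fun h => ⟨hx h, hy⟩, rfl⟩
  | succ k ih =>
    have hk := mt (prov_boxn_of_le (Nat.le_succ (k + 1))) hφ
    obtain ⟨z, hz⟩ := hrep _ hk
    exact ⟨z, fun h => ⟨hx h, hz (mem_sub_of_box h)⟩, ih hk hz⟩

lemma evalP_end_of_fpath_minFrame {φ : Formula} {k : ℕ} (h : boxn (k + 1) φ ∈ ψ.sub) {x y : W}
    (hxy : FPath (minFrame val ψ) φ (k + 1) x y) : evalP (val y) φ = false := by
  induction k generalizing x with
  | zero =>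
    obtain ⟨_, hu, rfl⟩ := hxy
    exact (hu h).2
  | succ k ih =>
    obtain ⟨u, -, hy⟩ := hxy
    exact ih (mem_sub_of_box h) hy

lemma subAcc_minFrame (hco : ∀ w, Coherent (m + 1) (n + 1) (val w))
    (hrep : ∀ ρ, ¬ Prov (m + 1) (n + 1) true ρ → ∃ w, ρ ∈ ψ.sub → evalP (val w) ρ = false) :
    SubAcc (minFrame val ψ) (m + 1) (n + 1) ψ.sub := by
  intro φ hφ x y hxy
  have hx : val x (boxn (m + 1) φ) = false := by
    obtain ⟨u, hu, -⟩ := hxy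
    exact (hu hφ).1
  have hnx : val x (boxn (n + 1) φ) = false := by
    by_contra hc
    have : val x (boxn (m + 1) φ) = true := (hco x).boxn_imp (by simpa [boxn, evalP] using hc)
    simp [hx] at this
  refine fpath_minFrame hrep (fun hp => ?_) (fun _ => hnx) (evalP_end_of_fpath_minFrame hφ hxy)
  have : val x (boxn (n + 1) φ) = true := hco x _ hp
  simp [hnx] at this

lemma fpath_maxFrame_of_false
    (hrep : ∀ ρ, ¬ Prov m n true ρ → ∃ w, ρ ∈ ψ.sub → evalP (val w) ρ = false)
    {φ : Formula} {k : ℕ} (hφ : ¬ Prov m n true (boxn (k + 1) φ)) {x : W}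
    (hx : boxn (k + 1) φ ∈ ψ.sub → val x (boxn (k + 1) φ) = false) (y : W) :
    FPath (maxFrame val ψ) φ (k + 1) x y := by
  induction k generalizing x with
  | zero => exact ⟨y, fun h hb => absurd hb (by have := hx h; simp_all [boxn]), rfl⟩
  | succ k ih =>
    have hk := mt (prov_boxn_of_le (Nat.le_succ (k + 1))) hφ
    obtain ⟨z, hz⟩ := hrep _ hk
    exact ⟨z, fun h hb => absurd hb (by have := hx h; simp_all [boxn]), ih hk hz⟩

lemma fpath_maxFrame_of_true
    (hrep : ∀ ρ, ¬ Prov m n true (neg ρ) → ∃ w, ρ ∈ ψ.sub → evalP (val w) ρ = true)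
    {φ : Formula} {k : ℕ} (hφ : ¬ Prov m n true (neg (boxn (k + 1) φ))) (x : W) {y : W}
    (hy : evalP (val y) φ = true) : FPath (maxFrame val ψ) φ (k + 1) x y := by
  induction k generalizing x with
  | zero => exact ⟨y, fun _ _ => hy, rfl⟩
  | succ k ih =>
    have hk := mt (prov_neg_boxn_of_le (Nat.le_succ k)) hφ
    obtain ⟨z, hz⟩ := hrep _ hk
    exact ⟨z, fun h _ => hz (mem_sub_of_box h), ih hk z⟩

lemma subAcc_maxFrame (hco : ∀ w, Coherent 0 n (val w))
    (hrep : ∀ ρ, ¬ Prov 0 n true ρ → ∃ w, ρ ∈ ψ.sub → evalP (val w) ρ = false)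
    (hrep' : ∀ ρ, ¬ Prov 0 n true (neg ρ) → ∃ w, ρ ∈ ψ.sub → evalP (val w) ρ = true) :
    SubAcc (maxFrame val ψ) 0 n ψ.sub := by
  rintro φ - x _ rfl
  cases n with
  | zero => rfl
  | succ n =>
    cases hx : val x (boxn (n + 1) φ) with
    | true =>
      refine fpath_maxFrame_of_true hrep' (fun hp => ?_) x ((hco x).boxn_imp hx)
      have : (!val x (boxn (n + 1) φ)) = true := hco x _ hp
      simp [hx] at this
    | false =>
      refine fpath_maxFrame_of_false hrep (fun hp => ?_) (fun _ => hx) x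
      have : val x (boxn (n + 1) φ) = true := hco x _ hp
      simp [hx] at this

end CanonicalModels

lemma hasFiniteCountermodel_of_canonical {m n : ℕ} (hmn : m = 0 ∨ n ≠ 0) {ψ : Formula}
    (hψ : ¬ Prov m n true ψ) : HasFiniteCountermodel m n ψ := by
  obtain ⟨W, _, val, hco, hval⟩ := exists_finite_representatives m n ψ.sub
  have hrep : ∀ ρ, ¬ Prov m n true ρ → ∃ w, ρ ∈ ψ.sub → evalP (val w) ρ = false := by
    intro ρ hρ
    obtain ⟨v, hv, hvρ⟩ := exists_coherent hρ
    obtain ⟨w, hw⟩ := hval v hv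
    exact ⟨w, fun h => (hw ρ h).trans hvρ⟩
  have hrep' : ∀ ρ, ¬ Prov m n true (neg ρ) → ∃ w, ρ ∈ ψ.sub → evalP (val w) ρ = true := by
    intro ρ hρ
    obtain ⟨v, hv, hvρ⟩ := exists_coherent hρ
    obtain ⟨w, hw⟩ := hval v hv
    exact ⟨w, fun h => (hw ρ h).trans (by simpa [evalP] using hvρ)⟩
  obtain ⟨w₀, hw₀⟩ := hrep ψ hψ
  have hbox : ∀ ρ w, box ρ ∈ ψ.sub → val w (box ρ) = false →
      ∃ w', evalP (val w') ρ = false := by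
    intro ρ w hρ hw
    obtain ⟨w', hw'⟩ := hrep ρ fun hp => by
      have : val w (box ρ) = true := hco w _ (.nec hp)
      simp [hw] at this
    exact ⟨w', hw' (mem_sub_of_box hρ)⟩
  rcases Nat.eq_zero_or_eq_succ_pred m with rfl | hm
  · refine hasFiniteCountermodel_of_truth (subAcc_maxFrame hco hrep hrep') (fun ρ w hρ => ?_)
      (hw₀ (self_mem_sub ψ))
    refine ⟨fun hw w' hr => hr hρ hw, fun h => ?_⟩
    by_contra hw
    obtain ⟨w', hw'⟩ := hbox ρ w hρ (by simpa using hw)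
    have := h w' fun _ hb => absurd hb hw
    simp [hw'] at this
  · obtain ⟨k, rfl⟩ : ∃ k, m = k + 1 := ⟨_, hm⟩
    obtain ⟨l, rfl⟩ : ∃ l, n = l + 1 := Nat.exists_eq_succ_of_ne_zero (by omega)
    refine hasFiniteCountermodel_of_truth (subAcc_minFrame hco hrep) (fun ρ w hρ => ?_)
      (hw₀ (self_mem_sub ψ))
    refine ⟨fun hw w' hr => absurd (hr hρ).1 (by simp [hw]), fun h => ?_⟩
    by_contra hw
    obtain ⟨w', hw'⟩ := hbox ρ w hρ (by simpa using hw)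
    have := h w' fun _ => ⟨by simpa using hw, hw'⟩
    simp [hw'] at this

section Labellings

variable {W : Type}

open Classical in
/-- the least natural number satisfying `P`, or `⊤` if there is none -/
noncomputable def firstTime (P : ℕ → Prop) : ℕ∞ :=
  if h : ∃ q, P q then (Nat.find h : ℕ∞) else ⊤

lemma firstTime_le_iff {P : ℕ → Prop} (hP : Monotone P) (q : ℕ) : firstTime P ≤ q ↔ P q := by
  classical
  unfold firstTime
  split_ifs with h
  · rw [Nat.cast_le]
    exact ⟨fun hq => hP hq (Nat.find_spec h), fun hq => Nat.find_min' h hq⟩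
  · simpa using fun hq => h ⟨q, hq⟩

open Classical in
lemma exists_sorting [Fintype W] (f : W → ℕ∞) :
    ∃ e : W ≃ Fin (Fintype.card W), ∀ w a,
      (e w : ℕ) < (Finset.univ.filter fun w => f w ≤ a).card ↔ f w ≤ a := by
  let e₀ := Fintype.equivFin W
  let σ := Tuple.sort (f ∘ e₀.symm)
  refine ⟨e₀.trans σ.symm, fun w a => ?_⟩
  have hcard : (Finset.univ.filter fun w => f w ≤ a).card =
      (Finset.univ.filter fun i => ((f ∘ e₀.symm) ∘ σ) i ≤ a).card :=
    Finset.card_equiv (e₀.trans σ.symm) (by simp)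
  rw [hcard, Tuple.lt_card_le_iff_apply_le_of_monotone (Tuple.monotone_sort _)]
  simp [σ]

open Classical in
lemma exists_labels [Fintype W] {m : ℕ} {val : W → Formula → Bool} (hco : ∀ w, Coherent m 0 (val w)) :
    ∃ e : Formula → W ≃ Fin (Fintype.card W), (∀ ρ, e (boxn m ρ) = e ρ) ∧ ∀ ρ w,
      (e ρ w : ℕ) < (Finset.univ.filter fun w => evalP (val w) ρ = true).card ↔
        evalP (val w) ρ = true := by
  let P : Formula → W → ℕ → Prop := fun χ w q => evalP (val w) (boxn (m * q) χ) = true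
  have hP : ∀ χ w, Monotone (P χ w) := fun χ w => monotone_nat_of_le_succ fun q hq => by
    change evalP (val w) (boxn (m * (q + 1)) χ) = true
    rw [Nat.mul_succ, Nat.add_comm, boxn_add]
    exact (hco w).boxn_imp hq
  choose e he using fun χ => exists_sorting fun w => firstTime (P χ w)
  refine ⟨fun ρ => e (ρ.root m), fun ρ => congrArg e (root_boxn m ρ), fun ρ w => ?_⟩
  have key : ∀ w, firstTime (P (ρ.root m) w) ≤ ((ρ.depth / m : ℕ) : ℕ∞) ↔
      evalP (val w) ρ = true := fun w => by
    rw [firstTime_le_iff (hP _ w)]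
    simp only [P, boxn_root]
  simpa only [key] using he (ρ.root m) w (ρ.depth / m : ℕ)

/-- each world has at most one `ρ`-successor, the one whose `ρ`-label is its `□ρ`-label -/
def labelFrame {N : ℕ} (val : W → Formula → Bool) (e : Formula → W ≃ Fin N) : NFrame W :=
  fun ρ x y => val x (box ρ) = false ∧ e ρ y = e (box ρ) x

lemma label_of_fpath {N : ℕ} {val : W → Formula → Bool} {e : Formula → W ≃ Fin N} {φ : Formula}
    {k : ℕ} {x y : W} (h : FPath (labelFrame val e) φ k x y) : e φ y = e (boxn k φ) x := by
  induction k generalizing x with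
  | zero => obtain rfl : x = y := h; rfl
  | succ k ih =>
    obtain ⟨u, hu, hy⟩ := h
    exact (ih hy).trans hu.2

open Classical in
lemma hasFiniteCountermodel_of_card_le [Fintype W] {m : ℕ} {ψ : Formula}
    {val : W → Formula → Bool}
    (hco : ∀ w, Coherent m 0 (val w))
    (hcard : ∀ ρ, box ρ ∈ ψ.sub →
      (Finset.univ.filter fun w => evalP (val w) ρ = true).card ≤
        (Finset.univ.filter fun w => evalP (val w) (box ρ) = true).card)
    {w₀ : W} (hw₀ : evalP (val w₀) ψ = false) : HasFiniteCountermodel m 0 ψ := by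
  obtain ⟨e, hem, he⟩ := exists_labels hco
  refine hasFiniteCountermodel_of_truth (R := labelFrame val e) (val := val)
    (fun φ _ x y hxy => ?_) (fun ρ x hρ => ?_) hw₀
  · have := label_of_fpath hxy
    rw [hem] at this
    exact ((e φ).injective this).symm
  · refine ⟨fun hx y hy => absurd hy.1 (by simp [hx]), fun h => ?_⟩
    by_contra hx
    have hy := h ((e ρ).symm (e (box ρ) x)) ⟨by simpa using hx, by simp⟩
    rw [← he ρ, Equiv.apply_symm_apply] at hy
    exact hx ((he (box ρ) x).1 (hy.trans_le (hcard ρ hρ)))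

end Labellings

section Sharpening

variable {m : ℕ}

open Classical in
/-- keep `v` on the subformulas of `χ`, make `□^(j+1) χ` true from `c ≤ j + 1` on (or when
forced by necessitation), and make every other atom true -/
noncomputable def sharpen (m : ℕ) (v : Formula → Bool) (χ : Formula) (c : ℕ) : Formula → Bool :=
  fun α => decide (if α ∈ χ.sub then v α = true else
    ∀ j, α = boxn (j + 1) χ → c ≤ j + 1 ∨ Prov m 0 true (boxn j χ))

lemma evalP_sharpen_of_mem {v : Formula → Bool} {χ : Formula} {c : ℕ} {ρ : Formula}
    (h : ρ ∈ χ.sub) : evalP (sharpen m v χ c) ρ = evalP v ρ :=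
  evalP_congr fun α hα => by simp [sharpen, sub_trans hα h]

lemma sharpen_of_notMem {v : Formula → Bool} {χ : Formula} {c : ℕ} {α : Formula}
    (h : α ∉ χ.sub) : sharpen m v χ c α = true ↔
      ∀ j, α = boxn (j + 1) χ → c ≤ j + 1 ∨ Prov m 0 true (boxn j χ) := by
  simp [sharpen, h]

lemma boxn_succ_notMem_sub (j : ℕ) (χ : Formula) : boxn (j + 1) χ ∉ χ.sub := fun h => by
  have := sizeOf_le_of_mem_sub h
  rw [sizeOf_boxn] at this
  omega

lemma sharpen_boxn_succ {v : Formula → Bool} {χ : Formula} {c j : ℕ} :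
    sharpen m v χ c (boxn (j + 1) χ) = true ↔ c ≤ j + 1 ∨ Prov m 0 true (boxn j χ) := by
  rw [sharpen_of_notMem (boxn_succ_notMem_sub j χ)]
  refine ⟨fun h => h j rfl, fun h i hi => ?_⟩
  have := congrArg depth hi
  rw [depth_boxn, depth_boxn] at this
  obtain rfl : j = i := by omega
  exact h

lemma not_prov_neg_box (φ : Formula) : ¬ Prov (m + 1) 0 true (neg (box φ)) := fun h =>
  validF_of_prov h Unit _ (accessible_empty fun h => (Nat.succ_ne_zero m h).elim)
    (fun _ _ => True) () fun _ hf => hf.elim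

lemma coherent_sharpen {v : Formula → Bool} (hv : Coherent (m + 1) 0 v) {χ : Formula}
    (hχ : χ.depth = 0) (hvχ : evalP v χ = false) (c : ℕ) :
    Coherent (m + 1) 0 (sharpen (m + 1) v χ c) := by
  refine coherent_of (fun φ hφ => ?_) (fun φ hφ => ?_) fun φ hφ => absurd hφ (not_prov_neg_box φ)
  · by_cases h : box φ ∈ χ.sub
    · exact (evalP_sharpen_of_mem h).trans (hv _ (.nec hφ))
    · refine (sharpen_of_notMem h).2 fun j hj => .inr ?_
      obtain rfl : φ = boxn j χ := Formula.box.inj hj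
      exact hφ
  · by_cases h : boxn (m + 1) φ ∈ χ.sub
    · rw [evalP_sharpen_of_mem h]
      have hφ' : φ ∈ χ.sub := mem_sub_of_boxn _ h
      rw [boxn, evalP_sharpen_of_mem hφ'] at hφ
      exact hv.boxn_imp hφ
    · refine (sharpen_of_notMem h).2 fun j hj => ?_
      obtain ⟨hd, he⟩ := eq_boxn_of_boxn_eq hχ hj
      change evalP _ φ = true at hφ
      cases hd' : φ.depth with
      | zero =>
        rw [hd'] at he
        obtain rfl : φ = χ := he
        rw [evalP_sharpen_of_mem (self_mem_sub φ)] at hφ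
        simp [hvχ] at hφ
      | succ d =>
        rw [he, hd'] at hφ
        rcases sharpen_boxn_succ.1 hφ with h | h
        · exact .inl (by omega)
        · exact .inr (prov_boxn_of_le (by omega) h)

end Sharpening

lemma one_add_mul_pow_le {a D s : ℕ} (hs : s < D) :
    a * (a + 1) ^ (D - (s + 1)) + 1 ≤ (a + 1) ^ (D - s) := by
  obtain ⟨d, hd⟩ : ∃ d, D - s = d + 1 := Nat.exists_eq_succ_of_ne_zero (by omega)
  rw [hd, show D - (s + 1) = d by omega, pow_succ]
  have := Nat.one_le_pow d (a + 1) (Nat.succ_pos a)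
  nlinarith

lemma hasFiniteCountermodel_succ_zero {m : ℕ} {ψ : Formula} (hψ : ¬ Prov (m + 1) 0 true ψ) :
    HasFiniteCountermodel (m + 1) 0 ψ := by
  classical
  obtain ⟨v₀, hv₀, hv₀ψ⟩ := exists_coherent hψ
  let I := {χ : Formula // χ ∈ ψ.sub ∧ χ.depth = 0 ∧ ¬ Prov (m + 1) 0 true χ}
  have : Finite I := Finite.of_injective (β := {χ // χ ∈ ψ.sub}) (fun χ => ⟨χ.1, χ.2.1⟩)
    fun a b h => Subtype.ext (congrArg (fun x => x.1) h)
  let _ : Fintype I := Fintype.ofFinite I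
  choose u hu huχ using fun χ : I => exists_coherent χ.2.2.2
  let D := sizeOf ψ
  let a := Fintype.card I * (D + 1)
  let W := Option (Σ χ : I, Fin (D + 1) × Fin ((a + 1) ^ (D - sizeOf χ.1)))
  let val : W → Formula → Bool := fun w =>
    w.elim v₀ fun s => sharpen (m + 1) (u s.1) s.1.1 s.2.1
  have hco : ∀ w, Coherent (m + 1) 0 (val w) := by
    rintro (_ | ⟨χ, c, i⟩)
    · exact hv₀
    · exact coherent_sharpen (hu χ) χ.2.2.1 (huχ χ) c
  refine hasFiniteCountermodel_of_card_le (val := val) hco (fun ρ hρ => ?_) (w₀ := none) hv₀ψ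
  by_cases hp : Prov (m + 1) 0 true ρ
  · exact Finset.card_le_card fun w _ => by simpa using hco w _ (.nec hp)
  obtain ⟨j, χ, hχ, rfl⟩ : ∃ j χ, χ.depth = 0 ∧ ρ = boxn j χ :=
    ⟨_, _, depth_core ρ, (boxn_depth_core ρ).symm⟩
  have hjD : j + 1 ≤ D := by
    have := sizeOf_le_of_mem_sub hρ
    change sizeOf (boxn (j + 1) χ) ≤ D at this
    rw [sizeOf_boxn] at this
    omega
  have hχψ : χ ∈ ψ.sub := mem_sub_of_boxn (j + 1) hρ
  let χ' : I := ⟨χ, hχψ, hχ, fun h => hp (prov_boxn j h)⟩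
  have hfalse : ∀ c : Fin (D + 1), j < c →
      evalP (sharpen (m + 1) (u χ') χ c) (boxn j χ) = false := by
    intro c hc
    cases j with
    | zero => exact (evalP_sharpen_of_mem (self_mem_sub χ)).trans (huχ χ')
    | succ i =>
      refine Bool.eq_false_iff.2 fun h => ?_
      rcases sharpen_boxn_succ.1 h with h | h
      · omega
      · exact hp (.nec h)
  rw [← Finset.card_sdiff_le_card_sdiff_iff]
  refine le_trans (b := (a + 1) ^ (D - sizeOf χ)) ?_ ?_
  · let g : W → Option (I × Fin (D + 1) × ℕ) :=
      Option.map fun s => (s.1, s.2.1, (s.2.2 : ℕ))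
    have hg : Function.Injective g := Option.map_injective (by
      rintro ⟨χ₁, c₁, i₁⟩ ⟨χ₂, c₂, i₂⟩ h
      simp only [Prod.mk.injEq] at h
      obtain ⟨rfl, rfl, h⟩ := h
      rw [Fin.ext h])
    have hsize : ∀ (χ₁ : I) c i,
        evalP (val (some ⟨χ₁, c, i⟩)) (boxn j χ) = true →
        evalP (val (some ⟨χ₁, c, i⟩)) (box (boxn j χ)) ≠ true → sizeOf χ < sizeOf χ₁.1 := by
      intro χ₁ c i h₁ h₂
      by_cases hmem : boxn (j + 1) χ ∈ χ₁.1.sub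
      · have := sizeOf_le_of_mem_sub hmem
        rw [sizeOf_boxn] at this
        omega
      · exfalso
        refine h₂ ((sharpen_of_notMem hmem).2 fun i' hi' => ?_)
        obtain ⟨hd, he⟩ := eq_boxn_of_boxn_eq (a := j + 1) χ₁.2.2.1 hi'
        rw [hχ] at hd he
        obtain rfl : χ₁ = χ' := Subtype.ext he.symm
        by_contra hc
        rw [not_or] at hc
        exact absurd h₁ (Bool.eq_false_iff.1 (hfalse c (by dsimp only at hc; omega)))
    by_cases hs : sizeOf χ < D
    · refine le_trans ?_ (one_add_mul_pow_le hs)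
      rw [← Finset.card_image_of_injective _ hg]
      refine (Finset.card_le_card (t := Finset.insertNone ((Finset.univ : Finset I) ×ˢ
        (Finset.univ : Finset (Fin (D + 1))) ×ˢ
          Finset.range ((a + 1) ^ (D - (sizeOf χ + 1))))) ?_).trans ?_
      · intro y hy
        obtain ⟨w, hw, rfl⟩ := Finset.mem_image.1 hy
        rw [Finset.mem_sdiff, Finset.mem_filter, Finset.mem_filter] at hw
        rcases w with _ | ⟨χ₁, c, i⟩
        · simp [g]
        · have hlt := hsize χ₁ c i hw.1.2 fun h => hw.2 ⟨Finset.mem_univ _, h⟩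
          have : (i : ℕ) < (a + 1) ^ (D - (sizeOf χ + 1)) :=
            i.2.trans_le (Nat.pow_le_pow_right (Nat.succ_pos a) (by omega))
          simpa [g] using this
      · rw [Finset.card_insertNone, Finset.card_product, Finset.card_product]
        simp [a, mul_assoc]
    · refine le_trans (Finset.card_le_card (t := {none}) ?_)
        (Nat.one_le_pow _ _ (Nat.succ_pos a))
      intro w hw
      rw [Finset.mem_sdiff, Finset.mem_filter, Finset.mem_filter] at hw
      rcases w with _ | ⟨χ₁, c, i⟩
      · simp
      · have hlt := hsize χ₁ c i hw.1.2 fun h => hw.2 ⟨Finset.mem_univ _, h⟩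
        have : sizeOf χ₁.1 ≤ D := sizeOf_le_of_mem_sub χ₁.2.1
        omega
  · let c : Fin (D + 1) := ⟨j + 1, by omega⟩
    let s : Fin ((a + 1) ^ (D - sizeOf χ)) → W := fun i => some ⟨χ', c, i⟩
    have hs : Function.Injective s := fun i i' h => by
      injection h with h
      simpa using h
    calc (a + 1) ^ (D - sizeOf χ) = (Finset.univ.image s).card := by
          rw [Finset.card_image_of_injective _ hs, Finset.card_univ, Fintype.card_fin]
      _ ≤ _ := Finset.card_le_card fun w hw => by
          obtain ⟨i, -, rfl⟩ := Finset.mem_image.1 hw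
          rw [Finset.mem_sdiff, Finset.mem_filter, Finset.mem_filter]
          refine ⟨⟨Finset.mem_univ _, sharpen_boxn_succ.2 (.inl le_rfl)⟩, fun h => ?_⟩
          exact absurd h.2 (Bool.eq_false_iff.1 (hfalse c (Nat.lt_succ_self j)))

lemma hasFiniteCountermodel {m n : ℕ} {ψ : Formula} (hψ : ¬ Prov m n true ψ) :
    HasFiniteCountermodel m n ψ := by
  by_cases h : m = 0 ∨ n ≠ 0
  · exact hasFiniteCountermodel_of_canonical h hψ
  · obtain ⟨k, rfl⟩ : ∃ k, m = k + 1 := Nat.exists_eq_succ_of_ne_zero (by omega)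
    obtain rfl : n = 0 := by omega
    exact hasFiniteCountermodel_succ_zero hψ

theorem stmt15 (m n : ℕ) (ψ : Formula) :
    List.TFAE
      [ Prov m n true ψ,
        ∀ (W : Type) [Nonempty W] (R : NFrame W), Accessible R m n → ValidF R ψ,
        ∀ (W : Type) [Fintype W] [Nonempty W] (R : NFrame W),
          Accessible R m n → ValidF R ψ,
        ∀ (W : Type) [Fintype W] [Nonempty W] (R : NFrame W),
          SubAcc R m n ψ.sub → ValidF R ψ ] := by
  tfae_have 1 → 2 := validF_of_prov
  tfae_have 2 → 3 := fun h W _ _ R => h W R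
  tfae_have 3 → 4 := fun h W _ _ R hR V w =>
    (sat_trimFrame_iff R m n ψ V (self_mem_sub ψ) w).1 (h W _ (accessible_trimFrame hR) V w)
  tfae_have 4 → 1 := fun h => by
    by_contra hψ
    obtain ⟨W, _, _, R, hR, hv⟩ := hasFiniteCountermodel hψ
    exact hv (h W R hR)
  tfae_finish
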